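/- Let (X, d) be a quasi metric space. For S ⊆ X²_f and (x,y) ∈ X²_f, let ι(S,(x,y)) = {(z,y) : (z,x) ∈ S and z ≤ x ≤ y}, let β(S) = S \ ⋃_{(x,y) ∈ X²_{f+}} ι(S,(x,y)), and let ι((x,y), X²_f) = {(x,w) : (y,w) ∈ X²_f and x ≤ y ≤ w}. Then the following are equivalent: (1) X is geodetic; (2) for every S ⊆ X²_f and every pair of distinct elements (x,y), (z,w) ∈ β(S), one has ι((x,y), X²_f) ∩ ι((z,w), X²_f) = ∅. -/

import Mathlib

open scoped ENNReal

/-- A quasi metric space: `d x y = 0 ↔ x = y` and the triangle inequality;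
infinite values and non-symmetry are allowed. -/
structure QuasiMetric (X : Type) : Type where
  d : X → X → ℝ≥0∞
  d_eq_zero_iff : ∀ x y : X, d x y = 0 ↔ x = y
  triangle : ∀ x y z : X, d x z ≤ d x y + d y z

namespace QuasiMetric

variable {X : Type} (q : QuasiMetric X)

/-- `q.Btw x y z` means `x ≤ y ≤ z`, i.e. `d x y + d y z = d x z`. -/
def Btw (x y z : X) : Prop := q.d x y + q.d y z = q.d x z

/-- A quasi metric space is geodetic if each interval `I(a,b)` (with `d a b < ∞`)
is totally ordered by `x ⪯ y ↔ a ≤ x ≤ y`. -/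
def Geodetic : Prop :=
  ∀ a b x y : X, q.d a b ≠ ∞ → q.Btw a x b → q.Btw a y b →
    q.Btw a x y ∨ q.Btw a y x

/-- `X²_f`: the pairs at finite distance. -/
def X2f : Set (X × X) := {p | q.d p.1 p.2 ≠ ∞}

/-- `X²_{f+}`: the pairs of distinct points at finite distance. -/
def X2fplus : Set (X × X) := {p | q.d p.1 p.2 ≠ ∞ ∧ p.1 ≠ p.2}

/-- `ι(S, (x,y)) = {(z,y) ∈ X²_f : (z,x) ∈ S, z ≤ x ≤ y}`. -/
def iotaR (S : Set (X × X)) (e : X × X) : Set (X × X) :=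
  {r | r ∈ q.X2f ∧ r.2 = e.2 ∧ (r.1, e.1) ∈ S ∧ q.Btw r.1 e.1 e.2}

/-- `β(S) = S \ ⋃_{(x,y) ∈ X²_{f+}} ι(S, (x,y))`. -/
def beta (S : Set (X × X)) : Set (X × X) :=
  S \ ⋃ e ∈ q.X2fplus, q.iotaR S e

/-- `ι((x,y), S) = {(x,w) ∈ X²_f : (y,w) ∈ S, x ≤ y ≤ w}`. -/
def iotaL (e : X × X) (S : Set (X × X)) : Set (X × X) :=
  {r | r ∈ q.X2f ∧ r.1 = e.1 ∧ (e.2, r.2) ∈ S ∧ q.Btw e.1 e.2 r.2}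

end QuasiMetric

namespace QuasiMetric

variable {X : Type} (q : QuasiMetric X)

theorem btw_self_right (x y : X) : q.Btw x y y := by
  simp [Btw, (q.d_eq_zero_iff y y).2 rfl]

variable {q} in
theorem Btw.ne_top {x y z : X} (h : q.Btw x y z) (hf : q.d x z ≠ ∞) :
    q.d x y ≠ ∞ ∧ q.d y z ≠ ∞ :=
  ENNReal.add_ne_top.1 (h.symm ▸ hf)

theorem notMem_beta_of_btw {S : Set (X × X)} (hS : S ⊆ q.X2f) {x y z : X}
    (hy : (x, y) ∈ S) (hz : (x, z) ∈ S) (hne : y ≠ z) (h : q.Btw x y z) :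
    (x, z) ∉ q.beta S := fun hb =>
  hb.2 <| Set.mem_biUnion (x := (y, z)) ⟨(h.ne_top (hS hz)).2, hne⟩ ⟨hS hz, rfl, hy, h⟩

theorem mem_beta_pair {a x y : X} (h : ¬ q.Btw a y x) :
    (a, x) ∈ q.beta {(a, x), (a, y)} := by
  refine ⟨Or.inl rfl, fun hu => ?_⟩
  obtain ⟨⟨u, v⟩, ⟨-, huv⟩, -, hv, hS, hb⟩ := Set.mem_iUnion₂.1 hu
  dsimp only at huv hv hS hb
  subst hv
  rcases hS with hS | hS
  · exact huv (congrArg Prod.snd hS)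
  · obtain rfl : u = y := congrArg Prod.snd hS
    exact h hb

end QuasiMetric

/-- A quasi metric space `X` is geodetic if and only if for every
`S ⊆ X²_f` and all distinct `(x,y), (z,w) ∈ β(S)` we have
`ι((x,y), X²_f) ∩ ι((z,w), X²_f) = ∅`. -/
theorem geodetic_iff_beta_iota_disjoint {X : Type} (q : QuasiMetric X) :
    q.Geodetic ↔
      ∀ S : Set (X × X), S ⊆ q.X2f →
        ∀ e₁ e₂ : X × X, e₁ ∈ q.beta S → e₂ ∈ q.beta S → e₁ ≠ e₂ →
          q.iotaL e₁ q.X2f ∩ q.iotaL e₂ q.X2f = ∅ := by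
  constructor
  · rintro hg S hS ⟨x, y⟩ ⟨x', y'⟩ h₁ h₂ hne
    rw [Set.eq_empty_iff_forall_notMem]
    rintro ⟨r, w⟩ ⟨⟨hf, hx, -, hb⟩, -, hx', -, hb'⟩
    dsimp only at hx hx' hb hb'
    subst hx hx'
    rcases hg _ _ _ _ hf hb hb' with h | h
    · exact q.notMem_beta_of_btw hS h₁.1 h₂.1 (fun e => hne (e ▸ rfl)) h h₂
    · exact q.notMem_beta_of_btw hS h₂.1 h₁.1 (fun e => hne (e ▸ rfl)) h h₁
  · intro h a b x y hf hx hy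
    by_contra! hn
    obtain ⟨hxy, hyx⟩ := hn
    have hne : x ≠ y := by
      rintro rfl
      exact hxy (q.btw_self_right a x)
    have hempty := h {(a, x), (a, y)} ?_ (a, x) (a, y)
      (q.mem_beta_pair hyx) (Set.pair_comm (a, x) (a, y) ▸ q.mem_beta_pair hxy)
      (fun e => hne (congrArg Prod.snd e))
    · have hmem : (a, b) ∈ q.iotaL (a, x) q.X2f ∩ q.iotaL (a, y) q.X2f :=
        ⟨⟨hf, rfl, (hx.ne_top hf).2, hx⟩, ⟨hf, rfl, (hy.ne_top hf).2, hy⟩⟩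
      rw [hempty] at hmem
      exact hmem
    · rintro p (rfl | rfl)
      exacts [(hx.ne_top hf).1, (hy.ne_top hf).1]
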